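/- With the hypotheses of the dominant-components lemma, V_dom = V(I : J^∞), where I = (F_1,...,F_n) ⊆ Q[X_1,...,X_n,T], J is the Jacobian determinant of F_1,...,F_n with respect to X_1,...,X_n, and (I : J^∞) is the saturation of I by J. In particular, if C is an irreducible component of V on which π is not dominant, then J vanishes identically on C. -/

import Mathlib

/-- A Zariski-closed subset of affine space `ℂᵐ`: the common zero set of a
family of polynomials. -/
def ZClosed {m : ℕ} (S : Set (Fin m → ℂ)) : Prop :=
  ∃ I : Set (MvPolynomial (Fin m) ℂ), S = {x | ∀ f ∈ I, MvPolynomial.eval x f = 0}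

/-- An irreducible affine variety: a nonempty Zariski-closed set which is not
the union of two proper Zariski-closed subsets. -/
def IsIrredVariety {m : ℕ} (C : Set (Fin m → ℂ)) : Prop :=
  ZClosed C ∧ C.Nonempty ∧
    ∀ A B : Set (Fin m → ℂ), ZClosed A → ZClosed B → C = A ∪ B → A = C ∨ B = C

/-- An irreducible component of `V`: a maximal irreducible variety contained
in `V`. -/
def IsIrredComponent {m : ℕ} (V C : Set (Fin m → ℂ)) : Prop :=
  IsIrredVariety C ∧ C ⊆ V ∧
    ∀ C' : Set (Fin m → ℂ), IsIrredVariety C' → C ⊆ C' → C' ⊆ V → C' = C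

/-- `C` has dimension at least `d`: there is a strictly increasing chain of
`d + 1` irreducible varieties ending at `C`. -/
def hasDimGE {m : ℕ} (C : Set (Fin m → ℂ)) (d : ℕ) : Prop :=
  ∃ ch : Fin (d + 1) → Set (Fin m → ℂ), (∀ i, IsIrredVariety (ch i)) ∧
    (∀ i j : Fin (d + 1), i < j → ch i ⊂ ch j) ∧ ch (Fin.last d) = C

/-- `C` has dimension exactly `d`. -/
def dimEq {m : ℕ} (C : Set (Fin m → ℂ)) (d : ℕ) : Prop :=
  hasDimGE C d ∧ ¬ hasDimGE C (d + 1)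

/-- The common zero set in `ℂ^{n+1}` of `F₁,…,Fₙ ∈ ℚ[X₁,…,Xₙ,T]` (the last
variable is `T`). -/
def zeroSet {n : ℕ} (F : Fin n → MvPolynomial (Fin (n + 1)) ℚ) :
    Set (Fin (n + 1) → ℂ) :=
  {x | ∀ i, MvPolynomial.aeval x (F i) = 0}

/-- The Jacobian determinant of `F₁,…,Fₙ` with respect to `X₁,…,Xₙ` (all the
variables but the last one, `T`). -/
noncomputable def jacDet {n : ℕ} (F : Fin n → MvPolynomial (Fin (n + 1)) ℚ) :
    MvPolynomial (Fin (n + 1)) ℚ :=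
  Matrix.det (Matrix.of fun i j : Fin n => MvPolynomial.pderiv (Fin.castSucc j) (F i))

/-- The projection `π(x, t) = t` on `ℂ^{n+1}`. -/
def projT {n : ℕ} (x : Fin (n + 1) → ℂ) : ℂ := x (Fin.last n)

/-- `Vdom`: the union of the irreducible components of the zero set of
`F₁,…,Fₙ` projecting dominantly onto `𝔸¹` under `π(x,t) = t` (a component
dominates `𝔸¹` iff its image under `π` is infinite, i.e. Zariski dense). -/
def Vdom {n : ℕ} (F : Fin n → MvPolynomial (Fin (n + 1)) ℚ) :
    Set (Fin (n + 1) → ℂ) :=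
  ⋃₀ {C | IsIrredComponent (zeroSet F) C ∧ (projT '' C).Infinite}


open MvPolynomial in
theorem zl_closed {m : ℕ} (I : Ideal (MvPolynomial (Fin m) ℂ)) : ZClosed (zeroLocus ℂ I) :=
  ⟨I, by ext x; simp [MvPolynomial.aeval_eq_eval]⟩

open MvPolynomial in
theorem zclosed_zl {m : ℕ} {S : Set (Fin m → ℂ)} (h : ZClosed S) :
    zeroLocus ℂ (vanishingIdeal ℂ S) = S := by
  obtain ⟨I, rfl⟩ := h
  refine le_antisymm ?_ (zeroLocus_vanishingIdeal_le _)
  intro x hx f hf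
  have := hx f (by intro y hy; simpa [MvPolynomial.aeval_eq_eval] using hy f hf)
  simpa [MvPolynomial.aeval_eq_eval] using this

open MvPolynomial in
theorem irred_zl {m : ℕ} (P : Ideal (MvPolynomial (Fin m) ℂ)) [hP : P.IsPrime] :
    IsIrredVariety (zeroLocus ℂ P) := by
  refine ⟨zl_closed P, ?_, ?_⟩
  · by_contra h
    rw [Set.not_nonempty_iff_eq_empty] at h
    have := IsPrime.vanishingIdeal_zeroLocus (K := ℂ) P
    rw [h, vanishingIdeal_empty] at this
    exact hP.ne_top this.symm
  · intro A B hA hB hAB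
    by_contra! hcon
    have key : ∀ A : Set (Fin m → ℂ), ZClosed A → A ⊆ zeroLocus ℂ P → A ≠ zeroLocus ℂ P →
        ∃ f, f ∈ vanishingIdeal ℂ A ∧ f ∉ P := by
      intro A hA hsub hne
      by_contra! h
      apply hne
      refine le_antisymm hsub ?_
      rw [← zclosed_zl hA]
      exact zeroLocus_anti_mono h
    obtain ⟨f, hf, hfP⟩ := key A hA (hAB ▸ Set.subset_union_left) hcon.1
    obtain ⟨g, hg, hgP⟩ := key B hB (hAB ▸ Set.subset_union_right) hcon.2
    have : f * g ∈ P := by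
      rw [← IsPrime.vanishingIdeal_zeroLocus (K := ℂ) P]
      intro x hx
      rw [hAB] at hx
      rcases hx with hx | hx
      · rw [map_mul, hf x hx, zero_mul]
      · rw [map_mul, hg x hx, mul_zero]
    exact (hP.mem_or_mem this).elim hfP hgP

open MvPolynomial in
theorem irred_prime {m : ℕ} {C : Set (Fin m → ℂ)} (hC : IsIrredVariety C) :
    (vanishingIdeal ℂ C).IsPrime := by
  obtain ⟨hcl, ⟨x, hx⟩, hirr⟩ := hC
  refine ⟨?_, ?_⟩
  · intro h
    have : (1 : MvPolynomial (Fin m) ℂ) ∈ vanishingIdeal ℂ C := h ▸ Submodule.mem_top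
    simpa using this x hx
  · intro f g hfg
    have hc : ∀ f : MvPolynomial (Fin m) ℂ, ZClosed (C ∩ {x | aeval x f = 0}) := by
      intro f
      obtain ⟨I, rfl⟩ := hcl
      refine ⟨insert f I, ?_⟩
      ext y
      simp [MvPolynomial.aeval_eq_eval, and_comm]
    rcases hirr _ _ (hc f) (hc g) (by
      ext y
      constructor
      · intro hy
        have := hfg y hy
        rw [map_mul, mul_eq_zero] at this
        exact this.imp (fun h => ⟨hy, h⟩) (fun h => ⟨hy, h⟩)
      · rintro (h | h) <;> exact h.1) with h | h
    · left; intro y hy; rw [← h] at hy; exact hy.2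
    · right; intro y hy; rw [← h] at hy; exact hy.2

open MvPolynomial in
theorem comp_of_min {m : ℕ} {I P : Ideal (MvPolynomial (Fin m) ℂ)} (hP : P ∈ I.minimalPrimes) :
    IsIrredComponent (zeroLocus ℂ I) (zeroLocus ℂ P) := by
  have hp : P.IsPrime := hP.1.1
  refine ⟨irred_zl P, zeroLocus_anti_mono hP.1.2, ?_⟩
  intro C' hC' h1 h2
  have hp' := irred_prime hC'
  have h3 : I ≤ vanishingIdeal ℂ C' := le_zeroLocus_iff_le_vanishingIdeal.1 h2
  have h4 : vanishingIdeal ℂ C' ≤ P := by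
    have := vanishingIdeal_anti_mono (k := ℂ) h1
    rwa [IsPrime.vanishingIdeal_zeroLocus] at this
  have h5 := hP.2 ⟨hp', h3⟩ h4
  rw [← zclosed_zl hC'.1, le_antisymm h4 h5]

open MvPolynomial in
theorem min_of_comp {m : ℕ} {I : Ideal (MvPolynomial (Fin m) ℂ)} {C : Set (Fin m → ℂ)}
    (hC : IsIrredComponent (zeroLocus ℂ I) C) : vanishingIdeal ℂ C ∈ I.minimalPrimes := by
  obtain ⟨h1, h2, h3⟩ := hC
  refine ⟨⟨irred_prime h1, le_zeroLocus_iff_le_vanishingIdeal.1 h2⟩, ?_⟩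
  rintro Q ⟨hQ, hIQ⟩ hle
  have := h3 (zeroLocus ℂ Q) (irred_zl Q) (le_zeroLocus_iff_le_vanishingIdeal.2 hle)
    (zeroLocus_anti_mono hIQ)
  rw [← this, IsPrime.vanishingIdeal_zeroLocus]

open MvPolynomial in
/-- Chevalley: a dominant projection of an irreducible variety to a line has cofinite image. -/
theorem cofinite_image {m : ℕ} (P : Ideal (MvPolynomial (Fin m) ℂ)) [hP : P.IsPrime]
    (s : Fin m) (hinf : ((fun x : Fin m → ℂ => x s) '' zeroLocus ℂ P).Infinite) :
    ∃ S : Finset ℂ, ∀ t ∉ S, ∃ x ∈ zeroLocus ℂ P, x s = t := by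
  classical
  let φ : Polynomial ℂ →ₐ[ℂ] (MvPolynomial (Fin m) ℂ ⧸ P) :=
    (Ideal.Quotient.mkₐ ℂ P).comp (Polynomial.aeval (X s))
  have hφ : ∀ p, φ p = Ideal.Quotient.mk P (Polynomial.aeval (X s) p) := fun p => rfl
  have hev : ∀ (x : Fin m → ℂ) (p : Polynomial ℂ),
      aeval x (Polynomial.aeval (X s : MvPolynomial (Fin m) ℂ) p) = p.eval (x s) := by
    intro x p
    rw [← Polynomial.aeval_algHom_apply]
    simp [Polynomial.aeval_def, Polynomial.eval₂_eq_eval_map]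
  have hinj : Function.Injective φ := by
    rw [injective_iff_map_eq_zero]
    intro p hp
    rw [hφ, Ideal.Quotient.eq_zero_iff_mem] at hp
    refine Polynomial.eq_zero_of_infinite_isRoot p (hinf.mono ?_)
    rintro _ ⟨x, hx, rfl⟩
    have := hx _ hp
    rw [hev] at this
    exact this
  have hft : φ.toRingHom.FinitePresentation := by
    refine RingHom.FinitePresentation.of_finiteType.1 ?_
    have h : (algebraMap ℂ (MvPolynomial (Fin m) ℂ ⧸ P)).FiniteType := by
      rw [RingHom.finiteType_algebraMap]
      infer_instance
    rw [← φ.comp_algebraMap] at h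
    exact RingHom.FiniteType.of_comp_finiteType h
  have hcon := PrimeSpectrum.isConstructible_range_comap hft
  obtain ⟨S, hS⟩ := PrimeSpectrum.exists_constructibleSetData_iff.mpr hcon
  have hbot : (⊥ : PrimeSpectrum (Polynomial ℂ)) ∈ S.toSet := by
    rw [hS]
    refine ⟨⊥, ?_⟩
    ext p
    simp only [PrimeSpectrum.comap_asIdeal, Ideal.mem_comap]
    change φ p ∈ (⊥ : Ideal _) ↔ p ∈ (⊥ : Ideal _)
    rw [Ideal.mem_bot, Ideal.mem_bot]
    exact map_eq_zero_iff φ hinj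
  simp only [PrimeSpectrum.ConstructibleSetData.toSet, Set.mem_iUnion] at hbot
  obtain ⟨B, hB, hb⟩ := hbot
  have hg : ∀ i, B.g i = 0 := by
    intro i
    have := hb.1 ⟨i, rfl⟩
    exact this
  have hf : B.f ≠ 0 := by
    intro h
    apply hb.2
    rw [h]
    simp
  refine ⟨B.f.roots.toFinset, ?_⟩
  intro t ht
  have ht' : B.f.eval t ≠ 0 := by
    intro h
    apply ht
    simp [hf, h]
  have hprime : (Ideal.span {Polynomial.X - Polynomial.C t}).IsPrime :=
    (Ideal.span_singleton_prime (Polynomial.X_sub_C_ne_zero t)).2 (Polynomial.prime_X_sub_C t)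
  have hmem : (⟨_, hprime⟩ : PrimeSpectrum (Polynomial ℂ)) ∈
      Set.range (PrimeSpectrum.comap φ.toRingHom) := by
    rw [← hS]
    simp only [PrimeSpectrum.ConstructibleSetData.toSet, Set.mem_iUnion]
    refine ⟨B, hB, ?_, ?_⟩
    · rintro _ ⟨i, rfl⟩
      rw [hg i]
      exact Ideal.zero_mem _
    · intro h
      have : B.f ∈ Ideal.span {Polynomial.X - Polynomial.C t} := h rfl
      rw [Ideal.mem_span_singleton, Polynomial.dvd_iff_isRoot] at this
      exact ht' this
  obtain ⟨Q, hQ⟩ := hmem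
  have hXt : (X s - C t : MvPolynomial (Fin m) ℂ) ∈
      Q.asIdeal.comap (Ideal.Quotient.mk P) := by
    have h1 : (Polynomial.X - Polynomial.C t) ∈
        (PrimeSpectrum.comap φ.toRingHom Q).asIdeal := by
      rw [hQ]
      exact Ideal.mem_span_singleton_self _
    have h2 : φ (Polynomial.X - Polynomial.C t) ∈ Q.asIdeal := h1
    rw [hφ] at h2
    simpa [Ideal.mem_comap] using h2
  have hQ' : (Q.asIdeal.comap (Ideal.Quotient.mk P)).IsPrime := inferInstance
  obtain ⟨M, hM, hQM⟩ := Ideal.exists_le_maximal _ hQ'.ne_top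
  obtain ⟨x, rfl⟩ := eq_vanishingIdeal_singleton_of_isMaximal ℂ hM
  refine ⟨x, ?_, ?_⟩
  · intro p hp
    refine hQM ?_ x rfl
    rw [Ideal.mem_comap, Ideal.Quotient.eq_zero_iff_mem.2 hp]
    exact Ideal.zero_mem _
  · have := hQM hXt x rfl
    simpa [sub_eq_zero] using this

open MvPolynomial in
theorem strict_deriv {m : ℕ} (p : MvPolynomial (Fin m) ℚ) (x : Fin m → ℂ) :
    HasStrictFDerivAt (fun y : Fin m → ℂ => aeval y p)
      (∑ j, aeval x (pderiv j p) • (ContinuousLinearMap.proj (R := ℂ) j : (Fin m → ℂ) →L[ℂ] ℂ))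
      x := by
  induction p using MvPolynomial.induction_on with
  | C a =>
    simp only [aeval_C, pderiv_C, map_zero]
    refine (hasStrictFDerivAt_const (𝕜 := ℂ) (algebraMap ℚ ℂ a) x).congr_fderiv ?_
    ext v
    simp
  | add p q hp hq =>
    simp only [map_add]
    refine (hp.add hq).congr_fderiv ?_
    ext v
    simp [add_mul, Finset.sum_add_distrib]
  | mul_X p i hp =>
    have h1 : HasStrictFDerivAt (fun y : Fin m → ℂ => y i)
      (ContinuousLinearMap.proj (R := ℂ) i : (Fin m → ℂ) →L[ℂ] ℂ) x :=
      (ContinuousLinearMap.proj (R := ℂ) i : (Fin m → ℂ) →L[ℂ] ℂ).hasStrictFDerivAt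
    have h2 := hp.mul h1
    simp only [map_mul, aeval_X]
    refine h2.congr_fderiv ?_
    ext v
    simp [pderiv_X, Pi.single_apply, Finset.mul_sum, add_mul, Finset.sum_add_distrib, apply_ite]
    refine Finset.sum_congr rfl fun _ _ => by ring

/-- The numerical Jacobian matrix at a point. -/
noncomputable def jacMat {n : ℕ} (F : Fin n → MvPolynomial (Fin (n + 1)) ℚ)
    (x : Fin (n + 1) → ℂ) : Matrix (Fin n) (Fin n) ℂ :=
  Matrix.of fun i j => MvPolynomial.aeval x (MvPolynomial.pderiv (Fin.castSucc j) (F i))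

open MvPolynomial in
theorem jacMat_det {n : ℕ} (F : Fin n → MvPolynomial (Fin (n + 1)) ℚ) (x : Fin (n + 1) → ℂ) :
    (jacMat F x).det = aeval x (jacDet F) := by
  rw [jacDet, AlgHom.map_det]
  rfl

open MvPolynomial Topology in
theorem local_lift {n : ℕ} (F : Fin n → MvPolynomial (Fin (n + 1)) ℚ) (x : Fin (n + 1) → ℂ)
    (hx : x ∈ zeroSet F) (hJ : aeval x (jacDet F) ≠ 0) (U : Set (Fin (n + 1) → ℂ))
    (hU : U ∈ 𝓝 x) : ∀ᶠ t in 𝓝 (projT x), ∃ y ∈ U, y ∈ zeroSet F ∧ projT y = t := by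
  let G : (Fin (n + 1) → ℂ) → (Fin n → ℂ) × ℂ := fun y => (fun i => aeval y (F i), y (Fin.last n))
  let G' : (Fin (n + 1) → ℂ) →L[ℂ] (Fin n → ℂ) × ℂ :=
    (ContinuousLinearMap.pi fun i => ∑ j, aeval x (pderiv j (F i)) •
      (ContinuousLinearMap.proj (R := ℂ) j : (Fin (n + 1) → ℂ) →L[ℂ] ℂ)).prod
      (ContinuousLinearMap.proj (R := ℂ) (Fin.last n) : (Fin (n + 1) → ℂ) →L[ℂ] ℂ)
  have hG : HasStrictFDerivAt G G' x := by
    refine HasStrictFDerivAt.prodMk ?_ ?_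
    · exact hasStrictFDerivAt_pi.2 fun i => strict_deriv (F i) x
    · exact (ContinuousLinearMap.proj (R := ℂ) (Fin.last n) :
        (Fin (n + 1) → ℂ) →L[ℂ] ℂ).hasStrictFDerivAt
  have hdet : IsUnit (jacMat F x).det := by rw [jacMat_det]; exact hJ.isUnit
  have hsurj : G'.range = ⊤ := by
    rw [LinearMap.range_eq_top]
    rintro ⟨v, s⟩
    let c : Fin n → ℂ := fun i => aeval x (pderiv (Fin.last n) (F i)) * s
    refine ⟨Fin.snoc ((jacMat F x)⁻¹.mulVec (v - c)) s, ?_⟩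
    have hM : (jacMat F x).mulVec ((jacMat F x)⁻¹.mulVec (v - c)) = v - c := by
      rw [Matrix.mulVec_mulVec, Matrix.mul_nonsing_inv _ hdet, Matrix.one_mulVec]
    refine Prod.ext ?_ ?_
    · funext i
      have := congrFun hM i
      simp only [Matrix.mulVec, dotProduct, jacMat, Matrix.of_apply, Pi.sub_apply] at this
      simp [G', Fin.sum_univ_castSucc]
      simp only [Matrix.mulVec, dotProduct, jacMat, Pi.sub_apply]
      rw [this]
      simp [c]
    · simp [G']
  have hmap := hG.map_nhds_eq_of_surj hsurj
  have hGx : G x = (0, projT x) := Prod.ext (funext fun i => hx i) rfl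
  have himg : G '' U ∈ 𝓝 ((0 : Fin n → ℂ), projT x) := by
    rw [← hGx, ← hmap]
    exact Filter.image_mem_map hU
  have hcont : Filter.Tendsto (fun t : ℂ => ((0 : Fin n → ℂ), t)) (𝓝 (projT x))
      (𝓝 ((0 : Fin n → ℂ), projT x)) :=
    (Continuous.prodMk continuous_const continuous_id).tendsto _
  filter_upwards [hcont himg] with t ht
  obtain ⟨y, hy, hyt⟩ := ht
  refine ⟨y, hy, fun i => congrFun (congrArg Prod.fst hyt) i, congrArg Prod.snd hyt⟩

open MvPolynomial in
theorem taylor_mem {m : ℕ} (p : MvPolynomial (Fin m) ℂ) (x : Fin m → ℂ) :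
    p - C (aeval x p) - ∑ j, C (aeval x (pderiv j p)) * (X j - C (x j)) ∈
      (vanishingIdeal ℂ {x}) ^ 2 := by
  induction p using MvPolynomial.induction_on with
  | C a => simp
  | add p q hp hq =>
    convert add_mem hp hq using 1
    simp only [map_add, add_mul, Finset.sum_add_distrib]
    ring
  | mul_X p i hp =>
    have h1 : (p - C (aeval x p)) * (X i - C (x i)) ∈ (vanishingIdeal ℂ {x}) ^ 2 := by
      rw [pow_two]
      refine Ideal.mul_mem_mul ?_ ?_ <;> rw [mem_vanishingIdeal_singleton_iff] <;> simp
    convert add_mem (Ideal.mul_mem_left _ (C (x i)) hp) h1 using 1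
    have : ∑ j, C (aeval x (pderiv j (p * X i))) * (X j - C (x j) : MvPolynomial (Fin m) ℂ) =
        C (x i) * (∑ j, C (aeval x (pderiv j p)) * (X j - C (x j))) +
          C (aeval x p) * (X i - C (x i)) := by
      have h2 : ∀ j, C (aeval x (pderiv j (p * X i))) * (X j - C (x j) : MvPolynomial (Fin m) ℂ) =
          C (x i) * (C (aeval x (pderiv j p)) * (X j - C (x j))) +
          (if j = i then C (aeval x p) * (X j - C (x j)) else 0) := by
        intro j
        rw [Derivation.leibniz, pderiv_X]
        by_cases h : j = i
        · subst h; simp; ring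
        · simp [h, Ne.symm h, eq_comm]; ring
      rw [Finset.sum_congr rfl fun j _ => h2 j, Finset.sum_add_distrib, Finset.mul_sum]
      simp
    rw [this]
    simp only [map_mul, aeval_X]
    ring

open MvPolynomial in
/-- A prime below the maximal ideal of a nondegenerate point that contains the equations and
`T - t` is that maximal ideal. -/
theorem prime_eq_max {n : ℕ} (F : Fin n → MvPolynomial (Fin (n + 1)) ℚ)
    (x : Fin (n + 1) → ℂ) (hJ : aeval x (jacDet F) ≠ 0)
    (P : Ideal (MvPolynomial (Fin (n + 1)) ℂ)) [hP : P.IsPrime]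
    (hF : ∀ i, map (algebraMap ℚ ℂ) (F i) ∈ P) (hxP : x ∈ zeroLocus ℂ P)
    (hT : X (Fin.last n) - C (projT x) ∈ P) : P = vanishingIdeal ℂ {x} := by
  set M : Ideal (MvPolynomial (Fin (n + 1)) ℂ) := vanishingIdeal ℂ {x} with hM
  have hPM : P ≤ M := fun p hp => (mem_vanishingIdeal_singleton_iff x p).2 (hxP p hp)
  have hlin : ∀ i, ∑ j : Fin n, C (jacMat F x i j) *
      (X (Fin.castSucc j) - C (x (Fin.castSucc j)) : MvPolynomial (Fin (n + 1)) ℂ) ∈ P ⊔ M ^ 2 := by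
    intro i
    have h1 := taylor_mem (map (algebraMap ℚ ℂ) (F i)) x
    rw [Fin.sum_univ_castSucc] at h1
    simp only [pderiv_map, aeval_map_algebraMap] at h1
    have h2 : aeval x (F i) = 0 := by
      have := hxP _ (hF i)
      rwa [aeval_map_algebraMap] at this
    rw [h2] at h1
    have h3 := Ideal.mul_mem_left P (C (aeval x (pderiv (Fin.last n) (F i)))) hT
    have h4 : map (algebraMap ℚ ℂ) (F i) - C (aeval x (pderiv (Fin.last n) (F i))) *
        (X (Fin.last n) - C (projT x)) ∈ P ⊔ M ^ 2 :=
      Ideal.mem_sup_left (sub_mem (hF i) h3)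
    have h5 := sub_mem h4 (Ideal.mem_sup_right (S := P) h1)
    convert h5 using 1
    simp only [jacMat, Matrix.of_apply, projT, map_zero]
    ring
  have hX : ∀ j : Fin (n + 1), (X j - C (x j) : MvPolynomial (Fin (n + 1)) ℂ) ∈ P ⊔ M ^ 2 := by
    intro j
    induction j using Fin.lastCases with
    | last => exact Ideal.mem_sup_left hT
    | cast k =>
      have h1 : ∑ i, C ((jacMat F x)⁻¹ k i) * ∑ j : Fin n, C (jacMat F x i j) *
        (X (Fin.castSucc j) - C (x (Fin.castSucc j)) : MvPolynomial (Fin (n + 1)) ℂ) ∈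
          P ⊔ M ^ 2 := sum_mem fun i _ => Ideal.mul_mem_left _ _ (hlin i)
      have hdet : IsUnit (jacMat F x).det := by rw [jacMat_det]; exact hJ.isUnit
      have h2 := Matrix.nonsing_inv_mul _ hdet
      simp_rw [Finset.mul_sum] at h1
      rw [Finset.sum_comm] at h1
      simp_rw [← mul_assoc, ← Finset.sum_mul, ← C_mul, ← map_sum] at h1
      have h3 : ∀ j, ∑ i, (jacMat F x)⁻¹ k i * jacMat F x i j = (1 : Matrix _ _ ℂ) k j := by
        intro j; rw [← h2, Matrix.mul_apply]
      simp_rw [h3, Matrix.one_apply] at h1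
      simpa [apply_ite] using h1
  have hMle : M ≤ P ⊔ M ^ 2 := by
    intro p hp
    have h0 : aeval x p = 0 := (mem_vanishingIdeal_singleton_iff x p).1 hp
    have h1 := taylor_mem p x
    rw [h0] at h1
    have h2 : ∑ j, C (aeval x (pderiv j p)) * (X j - C (x j)) ∈ P ⊔ M ^ 2 :=
      sum_mem fun j _ => Ideal.mul_mem_left _ _ (hX j)
    have h3 := add_mem (Ideal.mem_sup_right (S := P) h1) h2
    simpa using h3
  have hbar : IsIdempotentElem (M.map (Ideal.Quotient.mk P)) := by
    unfold IsIdempotentElem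
    rw [← Ideal.map_mul, ← pow_two]
    refine le_antisymm (Ideal.map_mono (Ideal.pow_le_self two_ne_zero)) ?_
    refine (Ideal.map_mono hMle).trans ?_
    rw [Ideal.map_sup, Ideal.map_quotient_self, bot_sup_eq]
  rcases (Ideal.isIdempotentElem_iff_eq_bot_or_top _ (IsNoetherian.noetherian _)).1 hbar with h | h
  · rw [Ideal.map_eq_bot_iff_le_ker, Ideal.mk_ker] at h
    exact le_antisymm hPM h
  · exfalso
    have h1 := congrArg (Ideal.comap (Ideal.Quotient.mk P)) h
    rw [Ideal.comap_map_of_surjective _ Ideal.Quotient.mk_surjective, Ideal.comap_top,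
      ← RingHom.ker_eq_comap_bot, Ideal.mk_ker, sup_eq_left.2 hPM] at h1
    have : M.IsPrime := by rw [hM]; infer_instance
    exact this.ne_top h1

open MvPolynomial in
/-- Apply a `ℚ`-linear functional to the coefficients of a complex polynomial. -/
noncomputable def coeffMap {m : ℕ} (l : ℂ →ₗ[ℚ] ℚ) (h : MvPolynomial (Fin m) ℂ) :
    MvPolynomial (Fin m) ℚ :=
  ∑ d ∈ h.support, monomial d (l (coeff d h))

open MvPolynomial in
theorem coeff_coeffMap {m : ℕ} (l : ℂ →ₗ[ℚ] ℚ) (h : MvPolynomial (Fin m) ℂ) (d : Fin m →₀ ℕ) :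
    coeff d (coeffMap l h) = l (coeff d h) := by
  classical
  simp only [coeffMap, coeff_sum, coeff_monomial, Finset.sum_ite_eq', mem_support_iff]
  split_ifs with h0
  · rfl
  · rw [not_not] at h0
    rw [h0, map_zero]

open MvPolynomial in
theorem coeffMap_mul {m : ℕ} (l : ℂ →ₗ[ℚ] ℚ) (h : MvPolynomial (Fin m) ℂ)
    (q : MvPolynomial (Fin m) ℚ) :
    coeffMap l (h * map (algebraMap ℚ ℂ) q) = coeffMap l h * q := by
  classical
  ext d
  rw [coeff_coeffMap, coeff_mul, coeff_mul, map_sum]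
  refine Finset.sum_congr rfl fun e _ => ?_
  rw [coeff_coeffMap, coeff_map, mul_comm, ← Algebra.smul_def, map_smul, smul_eq_mul, mul_comm]

open MvPolynomial in
theorem coeffMap_sum {m : ℕ} (l : ℂ →ₗ[ℚ] ℚ) {ι : Type*} (s : Finset ι)
    (h : ι → MvPolynomial (Fin m) ℂ) :
    coeffMap l (∑ i ∈ s, h i) = ∑ i ∈ s, coeffMap l (h i) := by
  ext d
  simp only [coeff_coeffMap, coeff_sum, map_sum]

open MvPolynomial in
theorem descent {m n : ℕ} (F : Fin n → MvPolynomial (Fin m) ℚ) (q : MvPolynomial (Fin m) ℚ)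
    (h : MvPolynomial (Fin m) ℂ)
    (hmem : h * map (algebraMap ℚ ℂ) q ∈
      Ideal.span (Set.range fun i => map (algebraMap ℚ ℂ) (F i)))
    (x : Fin m → ℂ)
    (hx : ∀ f : MvPolynomial (Fin m) ℚ, f * q ∈ Ideal.span (Set.range F) → aeval x f = 0) :
    aeval x h = 0 := by
  classical
  obtain ⟨c, hc⟩ := Ideal.mem_span_range_iff_exists_fun.1 hmem
  have hl : ∀ l : ℂ →ₗ[ℚ] ℚ, aeval x (coeffMap l h) = 0 := by
    intro l
    apply hx
    rw [← coeffMap_mul, ← hc, coeffMap_sum]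
    refine sum_mem fun i _ => ?_
    rw [coeffMap_mul]
    exact Ideal.mul_mem_left _ _ (Ideal.subset_span ⟨i, rfl⟩)
  let b := Module.Basis.ofVectorSpace ℚ ℂ
  let B := h.support.biUnion fun d => (b.repr (coeff d h)).support
  have hsum : h = ∑ i ∈ B, C (b i) * map (algebraMap ℚ ℂ) (coeffMap (b.coord i) h) := by
    ext d
    simp only [coeff_sum, coeff_C_mul, coeff_map, coeff_coeffMap]
    have h1 := b.linearCombination_repr (coeff d h)
    rw [Finsupp.linearCombination_apply, Finsupp.sum_of_support_subset (s := B)] at h1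
    · conv_lhs => rw [← h1]
      refine Finset.sum_congr rfl fun i _ => ?_
      rw [Algebra.smul_def, mul_comm]
      rfl
    · by_cases hd : d ∈ h.support
      · exact Finset.subset_biUnion_of_mem (fun d => (b.repr (coeff d h)).support) hd
      · rw [notMem_support_iff] at hd
        rw [hd]; simp
    · simp
  rw [hsum, map_sum]
  refine Finset.sum_eq_zero fun i _ => ?_
  rw [map_mul, aeval_map_algebraMap, hl, mul_zero]

open MvPolynomial in
/-- The complexified ideal. -/
noncomputable def idealC {n : ℕ} (F : Fin n → MvPolynomial (Fin (n + 1)) ℚ) :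
    Ideal (MvPolynomial (Fin (n + 1)) ℂ) :=
  Ideal.span (Set.range fun i => map (algebraMap ℚ ℂ) (F i))

open MvPolynomial in
theorem zeroSet_eq {n : ℕ} (F : Fin n → MvPolynomial (Fin (n + 1)) ℚ) :
    zeroSet F = zeroLocus ℂ (idealC F) := by
  rw [idealC, zeroLocus_span]
  ext x
  simp [zeroSet, aeval_map_algebraMap, -aeval_eq_eval, -coe_aeval_eq_eval]

open MvPolynomial in
theorem exists_min {m : ℕ} {I : Ideal (MvPolynomial (Fin m) ℂ)} {x : Fin m → ℂ}
    (hx : x ∈ zeroLocus ℂ I) : ∃ Q ∈ I.minimalPrimes, x ∈ zeroLocus ℂ Q := by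
  have h : I ≤ vanishingIdeal ℂ {x} :=
    fun p hp => (mem_vanishingIdeal_singleton_iff x p).2 (hx p hp)
  obtain ⟨Q, hQ, hle⟩ := Ideal.exists_minimalPrimes_le h
  exact ⟨Q, hQ, fun p hp => (mem_vanishingIdeal_singleton_iff x p).1 (hle hp)⟩

open MvPolynomial in
theorem cont_aeval {m : ℕ} (p : MvPolynomial (Fin m) ℚ) :
    Continuous fun x : Fin m → ℂ => aeval x p :=
  continuous_iff_continuousAt.2 fun x => (strict_deriv p x).continuousAt

open MvPolynomial in
theorem closed_zl {m : ℕ} (I : Ideal (MvPolynomial (Fin m) ℂ)) : IsClosed (zeroLocus ℂ I) := by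
  have : zeroLocus ℂ I = ⋂ p ∈ I, {x : Fin m → ℂ | eval x p = 0} := by
    ext x; simp [aeval_eq_eval]
  rw [this]
  exact isClosed_biInter fun p _ => isClosed_eq (continuous_eval p) continuous_const

open MvPolynomial Topology in
theorem nondeg_dominant {n : ℕ} (F : Fin n → MvPolynomial (Fin (n + 1)) ℚ)
    (P : Ideal (MvPolynomial (Fin (n + 1)) ℂ)) (hP : P ∈ (idealC F).minimalPrimes)
    (hJ : map (algebraMap ℚ ℂ) (jacDet F) ∉ P) : (projT '' zeroLocus ℂ P).Infinite := by
  classical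
  have hp : P.IsPrime := hP.1.1
  intro hfin
  have hprod : ∏ t ∈ hfin.toFinset, (X (Fin.last n) - C t) ∈ P := by
    refine (IsPrime.vanishingIdeal_zeroLocus (K := ℂ) P).le ?_
    intro x hx
    rw [map_prod]
    refine Finset.prod_eq_zero (i := projT x) (by simpa using ⟨x, hx, rfl⟩) ?_
    simp [projT]
  obtain ⟨t, -, ht⟩ := (hp.prod_mem_iff).1 hprod
  obtain ⟨x, hx, hJx⟩ : ∃ x ∈ zeroLocus ℂ P, aeval x (jacDet F) ≠ 0 := by
    by_contra! h
    apply hJ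
    rw [← IsPrime.vanishingIdeal_zeroLocus (K := ℂ) P]
    intro x hx
    rw [aeval_map_algebraMap]
    exact h x hx
  have hxt : projT x = t := by
    have := hx _ ht
    simpa [sub_eq_zero, projT] using this
  subst hxt
  have hPeq := prime_eq_max F x hJx P (fun i => hP.1.2 (Ideal.subset_span ⟨i, rfl⟩)) hx ht
  have hfinP := Ideal.finite_minimalPrimes_of_isNoetherianRing _ (idealC F)
  let Z : Set (Fin (n + 1) → ℂ) := ⋃ Q ∈ (idealC F).minimalPrimes \ {P}, zeroLocus ℂ Q
  have hZ : IsClosed Z := (hfinP.subset Set.sdiff_subset).isClosed_biUnion fun Q _ => closed_zl Q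
  have hxZ : x ∉ Z := by
    simp only [Z, Set.mem_iUnion, not_exists]
    rintro Q ⟨hQ, hne⟩ hxQ
    apply hne
    have hle : Q ≤ P := by
      rw [hPeq]
      exact fun p hp => (mem_vanishingIdeal_singleton_iff x p).2 (hxQ p hp)
    exact le_antisymm hle (hP.2 hQ.1 hle)
  have hxV : x ∈ zeroSet F := by
    rw [zeroSet_eq]
    exact zeroLocus_anti_mono hP.1.2 hx
  have hev := local_lift F x hxV hJx Zᶜ (hZ.isOpen_compl.mem_nhds hxZ)
  obtain ⟨t, ⟨y, hyU, hyV, hyt⟩, hne⟩ :=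
    ((hev.filter_mono nhdsWithin_le_nhds).and
      (self_mem_nhdsWithin : ({projT x}ᶜ : Set ℂ) ∈ 𝓝[≠] (projT x))).exists
  rw [zeroSet_eq] at hyV
  obtain ⟨Q, hQ, hyQ⟩ := exists_min hyV
  have hQP : Q = P := by
    by_contra h
    exact hyU (Set.mem_biUnion (show Q ∈ (idealC F).minimalPrimes \ {P} from ⟨hQ, h⟩) hyQ)
  subst hQP
  have := hyQ _ ht
  apply hne
  rw [← hyt]
  simpa [sub_eq_zero, projT] using this

open MvPolynomial Topology in
theorem dominant_nondeg {n D : ℕ} (F : Fin n → MvPolynomial (Fin (n + 1)) ℚ)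
    (hgen : ∃ T : Finset ℂ, ∀ t ∉ T,
      (zeroSet F ∩ {x | projT x = t}).Finite ∧
      (zeroSet F ∩ {x | projT x = t}).ncard ≤ D)
    (t0 : ℂ)
    (hfin : (zeroSet F ∩ {x | projT x = t0}).Finite)
    (hcard : (zeroSet F ∩ {x | projT x = t0}).ncard = D)
    (hJ : ∀ x ∈ zeroSet F ∩ {x | projT x = t0}, aeval x (jacDet F) ≠ 0)
    (P : Ideal (MvPolynomial (Fin (n + 1)) ℂ)) [hP : P.IsPrime] (hle : idealC F ≤ P)
    (hinf : (projT '' zeroLocus ℂ P).Infinite) : map (algebraMap ℚ ℂ) (jacDet F) ∉ P := by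
  classical
  intro hJP
  obtain ⟨S, hS⟩ := cofinite_image P (Fin.last n) hinf
  obtain ⟨T, hT⟩ := hgen
  set E := zeroSet F ∩ {x | projT x = t0} with hE
  obtain ⟨U, hU, hdisj⟩ := hfin.t2_separation
  have hev : ∀ᶠ t in 𝓝 t0, ∀ e ∈ E, ∃ y ∈ U e ∩ {y | aeval y (jacDet F) ≠ 0},
      y ∈ zeroSet F ∧ projT y = t := by
    rw [Filter.eventually_all_finite hfin]
    intro e he
    have := local_lift F e he.1 (hJ e he) (U e ∩ {y | aeval y (jacDet F) ≠ 0})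
      (Filter.inter_mem ((hU e).2.mem_nhds (hU e).1)
        ((isOpen_ne_fun (cont_aeval _) continuous_const).mem_nhds (hJ e he)))
    rwa [he.2] at this
  have hcof : ∀ᶠ t in 𝓝[≠] t0, t ∉ S ∪ T := by
    have h1 : ∀ᶠ t in 𝓝[≠] t0, t ∉ ((S ∪ T).erase t0 : Finset ℂ) := by
      refine Filter.Eventually.filter_mono nhdsWithin_le_nhds ?_
      exact ((S ∪ T).erase t0).finite_toSet.isClosed.isOpen_compl.mem_nhds (by simp)
    filter_upwards [h1, self_mem_nhdsWithin] with t ht hne h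
    exact ht (Finset.mem_erase.2 ⟨hne, h⟩)
  obtain ⟨t, ht1, ht2⟩ := ((hev.filter_mono nhdsWithin_le_nhds).and hcof).exists
  rw [Finset.mem_union, not_or] at ht2
  obtain ⟨z, hzP, hzt⟩ := hS t ht2.1
  obtain ⟨hTfin, hTcard⟩ := hT t ht2.2
  choose! y hy1 hy2 hy3 using ht1
  have hinj : Set.InjOn y E := by
    intro a ha b hb hab
    by_contra hne
    have := hdisj ha hb hne
    exact Set.disjoint_left.1 this (hy1 a ha).1 (hab ▸ (hy1 b hb).1)
  have hsub : y '' E ⊆ zeroSet F ∩ {x | projT x = t} := by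
    rintro _ ⟨e, he, rfl⟩
    exact ⟨hy2 e he, hy3 e he⟩
  have heq : y '' E = zeroSet F ∩ {x | projT x = t} := by
    refine Set.eq_of_subset_of_ncard_le hsub ?_ hTfin
    rw [hinj.ncard_image, hcard]
    exact hTcard
  have hz : z ∈ zeroSet F ∩ {x | projT x = t} := by
    refine ⟨?_, hzt⟩
    rw [zeroSet_eq]
    exact zeroLocus_anti_mono hle hzP
  rw [← heq] at hz
  obtain ⟨e, he, rfl⟩ := hz
  have := hzP _ hJP
  rw [aeval_map_algebraMap] at this
  exact (hy1 e he).2 this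

/-- **Dominant-components lemma, third part.** Under the stated hypotheses,
`Vdom = V(I : J^∞)`, the zero set of the saturation of `I = (F₁,…,Fₙ)` by the
Jacobian determinant `J`; in particular `J` vanishes identically on every
irreducible component of the zero set on which the projection is not
dominant. -/
theorem Vdom_eq_saturation (n D : ℕ) (hD : 0 < D)
    (F : Fin n → MvPolynomial (Fin (n + 1)) ℚ)
    (hgen : ∃ T : Finset ℂ, ∀ t ∉ T,
      (zeroSet F ∩ {x | projT x = t}).Finite ∧
      (zeroSet F ∩ {x | projT x = t}).ncard ≤ D)
    (t0 : ℂ)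
    (hfin : (zeroSet F ∩ {x | projT x = t0}).Finite)
    (hcard : (zeroSet F ∩ {x | projT x = t0}).ncard = D)
    (hJ : ∀ x ∈ zeroSet F ∩ {x | projT x = t0},
      MvPolynomial.aeval x (jacDet F) ≠ 0) :
    Vdom F = {x | ∀ f : MvPolynomial (Fin (n + 1)) ℚ,
        (∃ k : ℕ, f * jacDet F ^ k ∈ Ideal.span (Set.range F)) →
          MvPolynomial.aeval x f = 0}
      ∧ ∀ C, IsIrredComponent (zeroSet F) C → (projT '' C).Finite →
          ∀ x ∈ C, MvPolynomial.aeval x (jacDet F) = 0 := by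
  classical
  refine ⟨Set.Subset.antisymm ?_ ?_, ?_⟩
  · rintro x ⟨C, ⟨hC, hinf⟩, hxC⟩ f ⟨k, hk⟩
    rw [zeroSet_eq] at hC
    have hmin := min_of_comp hC
    have hp := hmin.1.1
    have hCeq := zclosed_zl hC.1.1
    have hJP := dominant_nondeg F hgen t0 hfin hcard hJ _ hmin.1.2 (by rwa [hCeq])
    have hmem : MvPolynomial.map (algebraMap ℚ ℂ) (f * jacDet F ^ k) ∈ idealC F := by
      have := Ideal.mem_map_of_mem (MvPolynomial.map (σ := Fin (n + 1)) (algebraMap ℚ ℂ)) hk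
      rw [Ideal.map_span, ← Set.range_comp] at this
      exact this
    have hmem' := hmin.1.2 hmem
    rw [map_mul, map_pow] at hmem'
    rcases hp.mem_or_mem hmem' with h | h
    · have := h x hxC
      rwa [MvPolynomial.aeval_map_algebraMap] at this
    · exact absurd (hp.mem_of_pow_mem _ h) hJP
  · intro x hx
    by_contra hnot
    have hfinP := Ideal.finite_minimalPrimes_of_isNoetherianRing _ (idealC F)
    have hex : ∀ P ∈ (idealC F).minimalPrimes, MvPolynomial.map (algebraMap ℚ ℂ) (jacDet F) ∉ P →
        ∃ g ∈ P, MvPolynomial.aeval x g ≠ 0 := by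
      intro P hP hJP
      by_contra! h
      exact hnot ⟨MvPolynomial.zeroLocus ℂ P, ⟨by rw [zeroSet_eq]; exact comp_of_min hP,
        nondeg_dominant F P hP hJP⟩, h⟩
    choose! g hg1 hg2 using hex
    let N := hfinP.toFinset.filter fun P => MvPolynomial.map (algebraMap ℚ ℂ) (jacDet F) ∉ P
    have hNmem : ∀ P, P ∈ N ↔ P ∈ (idealC F).minimalPrimes ∧
        MvPolynomial.map (algebraMap ℚ ℂ) (jacDet F) ∉ P := by
      intro P; simp [N]
    have hrad : (∏ P ∈ N, g P) * MvPolynomial.map (algebraMap ℚ ℂ) (jacDet F) ∈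
        (idealC F).radical := by
      rw [← Ideal.sInf_minimalPrimes, Ideal.mem_sInf]
      intro P hP
      by_cases hJP : MvPolynomial.map (algebraMap ℚ ℂ) (jacDet F) ∈ P
      · exact Ideal.mul_mem_left _ _ hJP
      · refine Ideal.mul_mem_right _ _ ?_
        rw [← Finset.mul_prod_erase N g ((hNmem P).2 ⟨hP, hJP⟩)]
        exact Ideal.mul_mem_right _ _ (hg1 P hP hJP)
    obtain ⟨k, hk⟩ := hrad
    rw [mul_pow, ← map_pow (MvPolynomial.map (algebraMap ℚ ℂ))] at hk
    have h0 := descent F (jacDet F ^ k) _ hk x fun f hf => hx f ⟨k, hf⟩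
    rw [map_pow, map_prod] at h0
    obtain ⟨P, hPN, hP0⟩ := Finset.prod_eq_zero_iff.1 (by by_contra h; exact pow_ne_zero k h h0)
    rw [hNmem] at hPN
    exact hg2 P hPN.1 hPN.2 hP0
  · intro C hC hfinC x hxC
    rw [zeroSet_eq] at hC
    have hmin := min_of_comp hC
    by_contra hJx
    refine nondeg_dominant F _ hmin (fun h => hJx ?_) (by rwa [zclosed_zl hC.1.1])
    have := h x hxC
    rwa [MvPolynomial.aeval_map_algebraMap] at this
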